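/- arXiv:1912.11814 — 2 statements merged into one kernel-verified Lean document; each statement's English description precedes it below -/
import Mathlib

section
/- Suppose H takes integer values on all subsets of V. Let X be a subset of V with 2 ≤ |X| and X ≠ V. Then H(V) − H(X) + R_NCO(X) ≤ R_NCO(V) holds if and only if f_{R_NCO(V)}(X) = f̂_{R_NCO(V)}(X), i.e., the residual entropy function evaluated at X at the integer parameter α = R_NCO(V) equals its Dilworth truncation at X. -/
open Finset

variable {ι : Type*} [DecidableEq ι]

/-- `P` is a partition of the finite set `X`: its blocks are nonempty,
pairwise disjoint, and their union is `X`. -/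
def IsPartition (X : Finset ι) (P : Finset (Finset ι)) : Prop :=
  (∀ C ∈ P, C.Nonempty) ∧
  (∀ C ∈ P, ∀ D ∈ P, C ≠ D → Disjoint C D) ∧
  P.sup id = X

/-- The residual entropy function `f_α(X) = α - H(V) + H(X)`. -/
noncomputable def fRes (H : Finset ι → ℝ) (V : Finset ι) (α : ℝ) (X : Finset ι) : ℝ :=
  α - H V + H X

/-- The Dilworth truncation `f̂_α(X) = min_{P ∈ Π(X)} Σ_{C ∈ P} f_α(C)`. -/
noncomputable def dilworth (H : Finset ι → ℝ) (V : Finset ι) (α : ℝ) (X : Finset ι) : ℝ :=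
  sInf { s : ℝ | ∃ P : Finset (Finset ι), IsPartition X P ∧ s = ∑ C ∈ P, fRes H V α C }

/-- The minimum sum-rate for the asymptotic model:
`R_ACO(X) = max_{P ∈ Π(X), |P| ≥ 2} Σ_{C ∈ P} (H(X) - H(C))/(|P| - 1)`. -/
noncomputable def RACO (H : Finset ι → ℝ) (X : Finset ι) : ℝ :=
  sSup { s : ℝ | ∃ P : Finset (Finset ι), IsPartition X P ∧ 2 ≤ P.card ∧
    s = ∑ C ∈ P, (H X - H C) / ((P.card : ℝ) - 1) }

/-- The minimum sum-rate for the non-asymptotic model: `R_NCO(X) = ⌈R_ACO(X)⌉`. -/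
noncomputable def RNCO (H : Finset ι → ℝ) (X : Finset ι) : ℝ :=
  (⌈RACO H X⌉ : ℝ)

theorem aux_finite (X : Finset ι) : {P : Finset (Finset ι) | IsPartition X P}.Finite := by
  refine (X.powerset.powerset.finite_toSet).subset ?_
  intro P hP
  simp only [Finset.coe_powerset, Set.mem_preimage, Set.mem_powerset_iff, Finset.mem_coe,
    Finset.mem_powerset]
  intro C hC
  have h := Finset.le_sup (f := id) hC
  rw [hP.2.2] at h
  simpa using h

theorem aux_bdd (X : Finset ι) (g : Finset (Finset ι) → ℝ) :
    BddAbove {s : ℝ | ∃ P, IsPartition X P ∧ 2 ≤ P.card ∧ s = g P} := by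
  refine (((aux_finite X).image g).subset ?_).bddAbove
  rintro s ⟨P, hP, _, rfl⟩
  exact ⟨P, hP, rfl⟩

theorem aux_bdd' (X : Finset ι) (g : Finset (Finset ι) → ℝ) :
    BddBelow {s : ℝ | ∃ P, IsPartition X P ∧ s = g P} := by
  refine (((aux_finite X).image g).subset ?_).bddBelow
  rintro s ⟨P, hP, rfl⟩
  exact ⟨P, hP, rfl⟩

theorem aux_singletons (X : Finset ι) : IsPartition X (X.image fun a => ({a} : Finset ι)) := by
  refine ⟨?_, ?_, ?_⟩
  · intro C hC
    obtain ⟨a, _, rfl⟩ := Finset.mem_image.1 hC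
    exact Finset.singleton_nonempty a
  · intro C hC D hD hne
    obtain ⟨a, _, rfl⟩ := Finset.mem_image.1 hC
    obtain ⟨b, _, rfl⟩ := Finset.mem_image.1 hD
    rw [Finset.disjoint_singleton]
    rintro rfl
    exact hne rfl
  · ext a
    simp [Finset.mem_sup]

theorem aux_trivial (X : Finset ι) (hX : X.Nonempty) : IsPartition X {X} := by
  refine ⟨?_, ?_, ?_⟩
  · intro C hC
    rw [Finset.mem_singleton.1 hC]; exact hX
  · intro C hC D hD hne
    exact absurd ((Finset.mem_singleton.1 hC).trans (Finset.mem_singleton.1 hD).symm) hne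
  · simp

theorem aux_raco (H : Finset ι → ℝ) (X : Finset ι) (hX2 : 2 ≤ X.card) (t : ℝ) :
    RACO H X ≤ t ↔ ∀ P, IsPartition X P → 2 ≤ P.card →
      (P.card : ℝ) * H X - ∑ C ∈ P, H C ≤ t * ((P.card : ℝ) - 1) := by
  unfold RACO
  rw [csSup_le_iff (aux_bdd X _)]
  · constructor
    · intro h P hP h2
      have h3 := h _ ⟨P, hP, h2, rfl⟩
      have h2' : (2 : ℝ) ≤ P.card := by exact_mod_cast h2
      rw [← Finset.sum_div, div_le_iff₀ (by linarith), Finset.sum_sub_distrib,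
        Finset.sum_const, nsmul_eq_mul] at h3
      exact h3
    · rintro h s ⟨P, hP, h2, rfl⟩
      have h3 := h P hP h2
      have h2' : (2 : ℝ) ≤ P.card := by exact_mod_cast h2
      rw [← Finset.sum_div, div_le_iff₀ (by linarith), Finset.sum_sub_distrib,
        Finset.sum_const, nsmul_eq_mul]
      exact h3
  · refine ⟨_, _, aux_singletons X, ?_, rfl⟩
    rw [Finset.card_image_of_injective _ Finset.singleton_injective]
    exact hX2

theorem aux_dil (H : Finset ι → ℝ) (V X : Finset ι) (hX : X.Nonempty) (α : ℝ) :
    fRes H V α X = dilworth H V α X ↔ ∀ P, IsPartition X P → 2 ≤ P.card →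
      (P.card : ℝ) * H X - ∑ C ∈ P, H C ≤ fRes H V α X * ((P.card : ℝ) - 1) := by
  have hb := aux_bdd' X (fun P => ∑ C ∈ P, fRes H V α C)
  have hm : fRes H V α X ∈ {s : ℝ | ∃ P, IsPartition X P ∧ s = ∑ C ∈ P, fRes H V α C} :=
    ⟨{X}, aux_trivial X hX, by simp⟩
  have hle : dilworth H V α X ≤ fRes H V α X := csInf_le hb hm
  have hs : ∀ P : Finset (Finset ι), ∑ C ∈ P, fRes H V α C
      = (P.card : ℝ) * (α - H V) + ∑ C ∈ P, H C := by
    intro P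
    simp only [fRes]
    rw [Finset.sum_add_distrib, Finset.sum_const, nsmul_eq_mul]
  constructor
  · intro h P hP _
    have h1 : dilworth H V α X ≤ ∑ C ∈ P, fRes H V α C := csInf_le hb ⟨P, hP, rfl⟩
    rw [← h, hs] at h1
    unfold fRes at h1 ⊢
    linarith
  · intro h
    refine le_antisymm (le_csInf ⟨_, hm⟩ ?_) hle
    rintro s ⟨P, hP, rfl⟩
    by_cases h2 : 2 ≤ P.card
    · have h1 := h P hP h2
      rw [hs]
      unfold fRes at h1 ⊢
      linarith
    · have : P.card = 0 ∨ P.card = 1 := by omega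
      rcases this with h0 | h1
      · rw [Finset.card_eq_zero] at h0
        subst h0
        have := hP.2.2
        simp at this
        exact absurd this.symm hX.ne_empty
      · obtain ⟨C, rfl⟩ := Finset.card_eq_one.1 h1
        have := hP.2.2
        simp at this
        subst this
        simp

theorem complimentary_iff_dilworth_nonasymptotic
    (V : Finset ι) (hV : 2 ≤ V.card) (H : Finset ι → ℝ)
    (hHint : ∀ X ⊆ V, ∃ z : ℤ, H X = z)
    (X : Finset ι) (hXV : X ⊆ V) (hX2 : 2 ≤ X.card) (hXne : X ≠ V) :
    H V - H X + RNCO H X ≤ RNCO H V ↔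
      fRes H V (RNCO H V) X = dilworth H V (RNCO H V) X := by
  have hX : X.Nonempty := Finset.card_pos.1 (by omega)
  rw [aux_dil H V X hX, ← aux_raco H X hX2]
  obtain ⟨v, hv⟩ := hHint V (Finset.Subset.refl V)
  obtain ⟨x, hx⟩ := hHint X hXV
  have hf : fRes H V (RNCO H V) X = ((⌈RACO H V⌉ - v + x : ℤ) : ℝ) := by
    unfold fRes RNCO
    rw [hv, hx]; push_cast; ring
  rw [hf, ← Int.ceil_le]
  unfold RNCO
  rw [hv, hx]
  constructor
  · intro h
    have h' : v - x + ⌈RACO H X⌉ ≤ ⌈RACO H V⌉ := by exact_mod_cast h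
    omega
  · intro h
    have h' : v - x + ⌈RACO H X⌉ ≤ ⌈RACO H V⌉ := by omega
    exact_mod_cast h'
end

section
/- Let α_low = Σ_{i ∈ V} (H(V) − H({i}))/(|V| − 1), let W ⊆ V be nonempty, and let P be a partition of W minimizing Σ_{C ∈ P'} f_{α_low}(C) over all partitions P' of W. Then every block C ∈ P with 2 ≤ |C| and C ≠ V is complimentary for the asymptotic model, i.e., satisfies H(V) − H(C) + R_ACO(C) ≤ R_ACO(V). -/
open Finset

variable {ι : Type*} [DecidableEq ι]

theorem isPartition_singletons (X : Finset ι) :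
    IsPartition X (X.image (fun i => ({i} : Finset ι))) := by
  refine ⟨?_, ?_, ?_⟩
  · intro C hC
    obtain ⟨i, _, rfl⟩ := Finset.mem_image.1 hC
    exact Finset.singleton_nonempty i
  · intro C hC D hD hne
    obtain ⟨i, _, rfl⟩ := Finset.mem_image.1 hC
    obtain ⟨j, _, rfl⟩ := Finset.mem_image.1 hD
    rw [Finset.disjoint_singleton]
    rintro rfl
    exact hne rfl
  · ext a
    simp [Finset.mem_sup]

theorem card_singletons (X : Finset ι) :
    (X.image (fun i => ({i} : Finset ι))).card = X.card :=
  Finset.card_image_of_injective _ Finset.singleton_injective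

theorem IsPartition.subset {X : Finset ι} {P : Finset (Finset ι)} (h : IsPartition X P)
    {C : Finset ι} (hC : C ∈ P) : C ⊆ X := by
  rw [← h.2.2]
  exact Finset.le_sup (f := id) hC

theorem raco_bdd (H : Finset ι → ℝ) (X : Finset ι) :
    BddAbove { s : ℝ | ∃ P : Finset (Finset ι), IsPartition X P ∧ 2 ≤ P.card ∧
    s = ∑ C ∈ P, (H X - H C) / ((P.card : ℝ) - 1) } := by
  apply Set.Finite.bddAbove
  apply Set.Finite.subset (Finset.finite_toSet (X.powerset.powerset.image
    (fun P : Finset (Finset ι) => ∑ C ∈ P, (H X - H C) / ((P.card : ℝ) - 1))))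
  rintro s ⟨P, hP, _, rfl⟩
  refine Finset.mem_coe.2 (Finset.mem_image.2 ⟨P, ?_, rfl⟩)
  rw [Finset.mem_powerset]
  intro C hC
  exact Finset.mem_powerset.2 (hP.subset hC)

theorem IsPartition.refine_block {W C : Finset ι} {P Q : Finset (Finset ι)}
    (hP : IsPartition W P) (hC : C ∈ P) (hQ : IsPartition C Q) :
    IsPartition W (P.erase C ∪ Q) ∧ Disjoint (P.erase C) Q := by
  have key : ∀ D ∈ P.erase C, ∀ E ∈ Q, Disjoint D E := by
    intro D hD E hE
    rw [Finset.mem_erase] at hD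
    exact (hP.2.1 D hD.2 C hC hD.1).mono_right (hQ.subset hE)
  refine ⟨⟨?_, ?_, ?_⟩, ?_⟩
  · intro D hD
    rcases Finset.mem_union.1 hD with h | h
    · exact hP.1 D (Finset.mem_of_mem_erase h)
    · exact hQ.1 D h
  · intro D hD E hE hne
    rcases Finset.mem_union.1 hD with h | h <;> rcases Finset.mem_union.1 hE with h' | h'
    · exact hP.2.1 D (Finset.mem_of_mem_erase h) E (Finset.mem_of_mem_erase h') hne
    · exact key D h E h'
    · exact (key E h' D h).symm
    · exact hQ.2.1 D h E h' hne
  · rw [Finset.sup_union, hQ.2.2, ← hP.2.2]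
    conv_rhs => rw [← Finset.insert_erase hC, Finset.sup_insert]
    exact sup_comm _ _
  · rw [Finset.disjoint_left]
    intro D hD hD'
    have := key D hD D hD'
    rw [disjoint_self] at this
    exact (hQ.1 D hD').ne_empty this

theorem minimizer_blocks_complimentary_asymptotic
    (V : Finset ι) (hV : 2 ≤ V.card) (H : Finset ι → ℝ)
    (αlow : ℝ) (hαlow : αlow = ∑ i ∈ V, (H V - H {i}) / ((V.card : ℝ) - 1))
    (W : Finset ι) (hWV : W ⊆ V) (hWne : W.Nonempty)
    (P : Finset (Finset ι)) (hP : IsPartition W P)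
    (hmin : ∀ P' : Finset (Finset ι), IsPartition W P' →
      (∑ C ∈ P, fRes H V αlow C) ≤ ∑ C ∈ P', fRes H V αlow C) :
    ∀ C ∈ P, 2 ≤ C.card → C ≠ V → H V - H C + RACO H C ≤ RACO H V := by
  intro C hC hC2 _
  have h1 : αlow ≤ RACO H V := by
    refine le_csSup (raco_bdd H V) ⟨_, isPartition_singletons V, ?_, ?_⟩
    · rw [card_singletons]; exact hV
    · rw [card_singletons, hαlow, Finset.sum_image]
      intro a _ b _ hab
      exact Finset.singleton_injective hab
  have h2 : RACO H C ≤ αlow - H V + H C := by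
    refine csSup_le ⟨_, _, isPartition_singletons C, ?_, rfl⟩ ?_
    · rw [card_singletons]; exact hC2
    · rintro s ⟨Q, hQ, hQ2, rfl⟩
      obtain ⟨hR, hd⟩ := hP.refine_block hC hQ
      have h := hmin _ hR
      rw [Finset.sum_union hd, ← Finset.add_sum_erase P _ hC] at h
      have hk : (2 : ℝ) ≤ Q.card := by exact_mod_cast hQ2
      rw [← Finset.sum_div, div_le_iff₀ (by linarith)]
      simp only [fRes, Finset.sum_add_distrib, Finset.sum_sub_distrib, Finset.sum_const,
        nsmul_eq_mul] at h ⊢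
      linarith
  linarith
end
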